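/- arXiv:1912.08538 — 2 statements merged into one kernel-verified Lean document; each statement's English description precedes it below -/
import Mathlib

section
/- Let E_R ⊊ E(S) be a proper subset of effects satisfying the consistency conditions (E1) and (E2), and suppose there exists an affine bijection Φ : E(S) → E_R (i.e., Φ(λe + (1−λ)f) = λΦ(e) + (1−λ)Φ(f) for all effects e, f and λ ∈ [0,1]). Then M_{E_R} is simulation closed, but E_R is not a convex subalgebra of E(S). -/
open scoped BigOperators

section GPT

variable {V : Type*} [NormedAddCommGroup V] [NormedSpace ℝ V]

/-- A function on a subset `S` is affine if it preserves convex combinations. -/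
def IsAffineOn (S : Set V) (f : S → ℝ) : Prop :=
  ∀ (x y : V) (hx : x ∈ S) (hy : y ∈ S) (a b : ℝ), 0 ≤ a → 0 ≤ b → a + b = 1 →
    ∀ (h : a • x + b • y ∈ S), f ⟨a • x + b • y, h⟩ = a * f ⟨x, hx⟩ + b * f ⟨y, hy⟩

/-- The set of effects on `S`: affine maps `S → ℝ` with values in `[0,1]`. -/
def Effects (S : Set V) : Set (S → ℝ) :=
  {f | IsAffineOn S f ∧ (∀ s, 0 ≤ f s) ∧ (∀ s, f s ≤ 1)}

/-- The unit effect `u`. -/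
def unitEff (S : Set V) : S → ℝ := fun _ => 1

/-- A meter: a finite family of effects summing to the unit effect. -/
structure Meter (S : Set V) where
  n : ℕ
  eff : Fin n → S → ℝ
  mem_effects : ∀ x, eff x ∈ Effects S
  sum_eq : ∑ x, eff x = unitEff S

/-- The range of a meter: all sums of effects over subsets of the outcome set. -/
def Meter.ran {S : Set V} (A : Meter S) : Set (S → ℝ) :=
  {f | ∃ Ω : Finset (Fin A.n), f = ∑ y ∈ Ω, A.eff y}

/-- A post-processing: a row-stochastic matrix. -/
def IsPostProcess {m k : ℕ} (ν : Fin m → Fin k → ℝ) : Prop :=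
  (∀ x y, 0 ≤ ν x y) ∧ ∀ x, ∑ y, ν x y = 1

/-- The simulation closure of a set of meters: mixtures of post-processings. -/
def Sim {S : Set V} (ℬ : Set (Meter S)) : Set (Meter S) :=
  {A | ∃ (m : ℕ) (B : Fin m → Meter S) (p : Fin m → ℝ)
      (ν : (i : Fin m) → Fin (B i).n → Fin A.n → ℝ),
      (∀ i, B i ∈ ℬ) ∧ (∀ i, 0 ≤ p i) ∧ (∑ i, p i = 1) ∧
      (∀ i, IsPostProcess (ν i)) ∧
      (∀ y, A.eff y = ∑ i, p i • ∑ x, ν i x y • (B i).eff x)}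

/-- A set of meters is simulation closed if it equals its simulation closure. -/
def SimClosed {S : Set V} (M' : Set (Meter S)) : Prop := Sim M' = M'

/-- The meters whose range is contained in a given set of effects. -/
def MetersOf {S : Set V} (R : Set (S → ℝ)) : Set (Meter S) :=
  {A | A.ran ⊆ R}

/-- The effects arising in the range of some meter in a given set of meters. -/
def EffectsOf {S : Set V} (M' : Set (Meter S)) : Set (S → ℝ) :=
  {e | e ∈ Effects S ∧ ∃ A ∈ M', e ∈ A.ran}

/-- Consistency condition (E1): the unit effect is available. -/
def CondE1 (S : Set V) (R : Set (S → ℝ)) : Prop := unitEff S ∈ R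

/-- Consistency condition (E2): every available effect occurs in some available meter. -/
def CondE2 (S : Set V) (R : Set (S → ℝ)) : Prop :=
  ∀ e ∈ R, ∃ A ∈ MetersOf R, e ∈ A.ran

/-- The largest value of an effect on the state space. -/
noncomputable def lmax {S : Set V} (f : S → ℝ) : ℝ := ⨆ s, f s

/-- The smallest value of an effect on the state space. -/
noncomputable def lmin {S : Set V} (f : S → ℝ) : ℝ := ⨅ s, f s

/-- Effectively `n`-tomic meters: the simulation closure of meters with at most
`n` outcomes. -/
def MEff (S : Set V) (n : ℕ) : Set (Meter S) := Sim {A : Meter S | A.n ≤ n}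

/-- A convex subalgebra of the set of effects. -/
def IsConvexSubalgebra (S : Set V) (R : Set (S → ℝ)) : Prop :=
  R ⊆ Effects S ∧ unitEff S ∈ R ∧
  (∀ e ∈ R, unitEff S - e ∈ R) ∧
  (∀ e ∈ R, ∀ f ∈ R, e + f ∈ Effects S → e + f ∈ R) ∧
  (∀ a : ℝ, a ∈ Set.Icc (0:ℝ) 1 → ∀ e ∈ R, a • e ∈ R)

/-- Two meters are compatible if both can be simulated from a single meter. -/
def Compatible {S : Set V} (A B : Meter S) : Prop :=
  ∃ C : Meter S, A ∈ Sim {C} ∧ B ∈ Sim {C}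

/-- The set of meters compatible with a given meter. -/
def CompatSet {S : Set V} (A : Meter S) : Set (Meter S) :=
  {B | Compatible A B}

/-- The noise content of a meter with respect to trivial meters. -/
noncomputable def noiseContent {S : Set V} (B : Meter S) : ℝ :=
  sSup {l : ℝ | l ∈ Set.Icc (0:ℝ) 1 ∧
    ∃ (p : Fin B.n → ℝ) (Ceff : Fin B.n → S → ℝ),
      (∀ x, 0 ≤ p x) ∧ (∑ x, p x = 1) ∧
      (∀ x, Ceff x ∈ Effects S) ∧ (∑ x, Ceff x = unitEff S) ∧
      ∀ x, B.eff x = l • (p x • unitEff S) + (1 - l) • Ceff x}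

/-- The set `R_t` of meters that are `t`-noisy versions of some meter with the
same outcome set. -/
def Rt (S : Set V) (t : ℝ) : Set (Meter S) :=
  {A | ∃ (Beff : Fin A.n → S → ℝ) (p : Fin A.n → ℝ),
      (∀ x, Beff x ∈ Effects S) ∧ (∑ x, Beff x = unitEff S) ∧
      (∀ x, 0 ≤ p x) ∧ (∑ x, p x = 1) ∧
      ∀ x, A.eff x = t • Beff x + ((1 - t) * p x) • unitEff S}

end GPT
section AffineGraph

variable {E F : Type*} [AddCommGroup E] [Module ℝ E] [AddCommGroup F] [Module ℝ F]

/-- A convex relation that is the graph of a partial function respects all vanishing linear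
combinations whose coefficients sum to zero. -/
lemma Convex.sum_smul_snd_eq_zero {G : Set (E × F)} (hG : Convex ℝ G)
    (hfun : ∀ p ∈ G, ∀ q ∈ G, p.1 = q.1 → p.2 = q.2)
    {ι : Type*} (t : Finset ι) (c : ι → ℝ) (p : ι → E × F) (hp : ∀ i ∈ t, p i ∈ G)
    (hc : ∑ i ∈ t, c i = 0) (h1 : ∑ i ∈ t, c i • (p i).1 = 0) :
    ∑ i ∈ t, c i • (p i).2 = 0 := by
  have hsplit : ∀ i, c i = (c i)⁺ - (c i)⁻ := fun i => (posPart_sub_negPart (c i)).symm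
  have hmass : ∑ i ∈ t, (c i)⁺ = ∑ i ∈ t, (c i)⁻ := by
    rw [← sub_eq_zero, ← Finset.sum_sub_distrib, ← hc]
    exact Finset.sum_congr rfl fun i _ => (hsplit i).symm
  rcases (Finset.sum_nonneg fun i _ => posPart_nonneg (c i) :
      0 ≤ ∑ i ∈ t, (c i)⁺).eq_or_lt with h0 | hpos
  · have hz : ∀ i ∈ t, c i = 0 := fun i hi => by
      have hp0 := (Finset.sum_eq_zero_iff_of_nonneg fun i _ => posPart_nonneg (c i)).1 h0.symm i hi
      have hn0 := (Finset.sum_eq_zero_iff_of_nonneg fun i _ => negPart_nonneg (c i)).1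
        (hmass ▸ h0.symm) i hi
      rw [hsplit i, hp0, hn0, sub_zero]
    exact Finset.sum_eq_zero fun i hi => by rw [hz i hi, zero_smul]
  · have hP := hG.centerMass_mem (fun i _ => posPart_nonneg (c i)) hpos hp
    have hN := hG.centerMass_mem (fun i _ => negPart_nonneg (c i)) (hmass ▸ hpos) hp
    have hdiff : ∑ i ∈ t, (c i)⁺ • p i - ∑ i ∈ t, (c i)⁻ • p i = ∑ i ∈ t, c i • p i := by
      rw [← Finset.sum_sub_distrib]
      exact Finset.sum_congr rfl fun i _ => by rw [← sub_smul, ← hsplit]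
    have hcm : t.centerMass (fun i => (c i)⁺) p - t.centerMass (fun i => (c i)⁻) p =
        (∑ i ∈ t, (c i)⁺)⁻¹ • ∑ i ∈ t, c i • p i := by
      rw [Finset.centerMass, Finset.centerMass, ← hmass, ← smul_sub, hdiff]
    have hfst : (t.centerMass (fun i => (c i)⁺) p).1 = (t.centerMass (fun i => (c i)⁻) p).1 := by
      rw [← sub_eq_zero, ← Prod.fst_sub, hcm, Prod.smul_fst, Prod.fst_sum]
      simp only [Prod.smul_fst, h1, smul_zero]
    have hsnd := hfun _ hP _ hN hfst
    rw [← sub_eq_zero, ← Prod.snd_sub, hcm, Prod.smul_snd, Prod.snd_sum] at hsnd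
    simpa only [Prod.smul_snd, smul_eq_zero, inv_eq_zero, hpos.ne', false_or] using hsnd

/-- A convex set containing all subset sums of a finite family contains all combinations of the
family with coefficients in `[0, 1]`. -/
lemma Convex.sum_smul_mem_of_subset_sums {R : Set E} (hR : Convex ℝ R) {ι : Type*} [Fintype ι]
    (v : ι → E) (hv : ∀ t : Finset ι, ∑ i ∈ t, v i ∈ R) (c : ι → ℝ) (h0 : ∀ i, 0 ≤ c i)
    (h1 : ∀ i, c i ≤ 1) : ∑ i, c i • v i ∈ R := by
  classical
  have hmem : ∑ i, c i • v i ∈ parallelepiped v :=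
    (mem_parallelepiped_iff v _).2 ⟨c, ⟨h0, h1⟩, rfl⟩
  rw [parallelepiped_eq_convexHull] at hmem
  refine convexHull_min ?_ hR hmem
  intro x hx
  obtain ⟨g, hg, rfl⟩ := (Set.mem_finsetSum _ _ _).1 hx
  convert hv {i | g i ≠ 0} using 1
  rw [Finset.sum_filter]
  refine Finset.sum_congr rfl fun i hi => ?_
  rcases hg hi with h | h
  · simp [h]
  · rw [Set.mem_singleton_iff] at h
    by_cases hz : g i = 0 <;> simp [hz, ← h]

end AffineGraph

section Effects

variable {V : Type*} [NormedAddCommGroup V] [NormedSpace ℝ V]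

/-- The affine functions on `S` as a linear subspace of all functions. -/
def affineFunctions (S : Set V) : Submodule ℝ (S → ℝ) where
  carrier := {f | IsAffineOn S f}
  zero_mem' := fun x y hx hy a b ha hb hab h => by simp
  add_mem' := fun {f g} hf hg x y hx hy a b ha hb hab h => by
    simp only [Pi.add_apply, hf x y hx hy a b ha hb hab h, hg x y hx hy a b ha hb hab h]
    ring
  smul_mem' := fun r f hf x y hx hy a b ha hb hab h => by
    simp only [Pi.smul_apply, smul_eq_mul, hf x y hx hy a b ha hb hab h]
    ring

lemma IsAffineOn.exists_dual {S : Set V} (hS : Convex ℝ S) {f : S → ℝ} (hf : IsAffineOn S f) :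
    ∃ g : Module.Dual ℝ (V × ℝ), ∀ s : S, f s = g ((s : V), 1) := by
  let L : (S →₀ ℝ) →ₗ[ℝ] V × ℝ := Finsupp.linearCombination ℝ fun s : S => ((s : V), (1 : ℝ))
  let φ : (S →₀ ℝ) →ₗ[ℝ] ℝ := Finsupp.linearCombination ℝ f
  let G : Set (V × ℝ) := Set.range fun s : S => ((s : V), f s)
  have hG : Convex ℝ G := by
    rintro _ ⟨x, rfl⟩ _ ⟨y, rfl⟩ a b ha hb hab
    exact ⟨⟨_, hS x.2 y.2 ha hb hab⟩,
      Prod.ext rfl (hf x y x.2 y.2 a b ha hb hab (hS x.2 y.2 ha hb hab))⟩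
  have hfun : ∀ p ∈ G, ∀ q ∈ G, p.1 = q.1 → p.2 = q.2 := by
    rintro _ ⟨x, rfl⟩ _ ⟨y, rfl⟩ h
    exact congrArg f (Subtype.ext h)
  have hker : LinearMap.ker L ≤ LinearMap.ker φ := by
    intro c hc
    rw [LinearMap.mem_ker, Finsupp.linearCombination_apply, Finsupp.sum] at hc ⊢
    refine hG.sum_smul_snd_eq_zero hfun c.support c (fun s => ((s : V), f s))
      (fun i _ => ⟨i, rfl⟩) ?_ ?_
    · simpa [Prod.snd_sum] using congrArg Prod.snd hc
    · simpa [Prod.fst_sum] using congrArg Prod.fst hc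
  obtain ⟨g, hg⟩ := LinearMap.exists_extend
    (((LinearMap.ker L).liftQ φ hker).comp L.quotKerEquivRange.symm.toLinearMap)
  refine ⟨g, fun s => ?_⟩
  have hL : L (Finsupp.single s 1) = ((s : V), 1) := by simp [L]
  have hφ : φ (Finsupp.single s 1) = f s := by simp [φ]
  have h := LinearMap.congr_fun hg ⟨L (Finsupp.single s 1), LinearMap.mem_range_self _ _⟩
  simp only [LinearMap.comp_apply, LinearEquiv.coe_coe, Submodule.subtype_apply,
    LinearMap.quotKerEquivRange_symm_apply_image, Submodule.mkQ_apply, Submodule.liftQ_apply] at h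
  rw [← hφ, ← h, hL]

lemma finiteDimensional_affineFunctions [FiniteDimensional ℝ V] {S : Set V} (hS : Convex ℝ S) :
    FiniteDimensional ℝ (affineFunctions S) := by
  let T : Module.Dual ℝ (V × ℝ) →ₗ[ℝ] (S → ℝ) :=
    LinearMap.pi fun s => Module.Dual.eval ℝ (V × ℝ) ((s : V), 1)
  have hle : affineFunctions S ≤ LinearMap.range T := fun f hf => by
    obtain ⟨g, hg⟩ := IsAffineOn.exists_dual hS hf
    exact ⟨g, funext fun s => (hg s).symm⟩
  exact Submodule.finiteDimensional_of_le hle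

lemma convex_effects (S : Set V) : Convex ℝ (Effects S) := by
  intro e he f hf a b ha hb hab
  refine ⟨(affineFunctions S).add_mem ((affineFunctions S).smul_mem a he.1)
    ((affineFunctions S).smul_mem b hf.1), fun s => ?_, fun s => ?_⟩
  · exact add_nonneg (mul_nonneg ha (he.2.1 s)) (mul_nonneg hb (hf.2.1 s))
  · calc a * e s + b * f s ≤ a * 1 + b * 1 := add_le_add
          (mul_le_mul_of_nonneg_left (he.2.2 s) ha) (mul_le_mul_of_nonneg_left (hf.2.2 s) hb)
      _ = 1 := by rw [mul_one, mul_one, hab]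

lemma zero_mem_effects (S : Set V) : (0 : S → ℝ) ∈ Effects S :=
  ⟨(affineFunctions S).zero_mem, fun _ => le_rfl, fun _ => zero_le_one⟩

/-- The meters restricted to a convex set of effects are simulation closed. -/
lemma simClosed_metersOf {S : Set V} {R : Set (S → ℝ)} (hR : Convex ℝ R) :
    SimClosed (MetersOf R) := by
  classical
  refine Set.Subset.antisymm ?_ ?_
  · rintro A ⟨m, B, p, ν, hB, hp0, hp1, hν, hA⟩ _ ⟨Ω, rfl⟩
    have hsum : ∑ y ∈ Ω, A.eff y = ∑ i, p i • ∑ x, (∑ y ∈ Ω, ν i x y) • (B i).eff x := by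
      simp only [hA]
      rw [Finset.sum_comm]
      refine Finset.sum_congr rfl fun i _ => ?_
      rw [← Finset.smul_sum, Finset.sum_comm]
      simp only [Finset.sum_smul]
    rw [hsum]
    refine hR.sum_mem (fun i _ => hp0 i) hp1 fun i _ => ?_
    refine hR.sum_smul_mem_of_subset_sums _ (fun t => hB i ⟨t, rfl⟩) _
      (fun x => Finset.sum_nonneg fun y _ => (hν i).1 x y) fun x => ?_
    rw [← (hν i).2 x]
    exact Finset.sum_le_sum_of_subset_of_nonneg (Finset.subset_univ _) fun y _ _ => (hν i).1 x y
  · intro A hA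
    refine ⟨1, fun _ => A, fun _ => 1, fun _ x y => if x = y then 1 else 0, fun _ => hA,
      fun _ => zero_le_one, by simp, fun _ => ⟨fun x y => ?_, fun x => by simp⟩, fun y => by simp⟩
    dsimp only
    split_ifs <;> norm_num

namespace IsConvexSubalgebra

variable {S : Set V} {R : Set (S → ℝ)}

lemma zero_mem (h : IsConvexSubalgebra S R) : (0 : S → ℝ) ∈ R := by
  simpa using h.2.2.2.2 0 ⟨le_rfl, zero_le_one⟩ _ h.2.1

lemma convex (h : IsConvexSubalgebra S R) : Convex ℝ R := by
  intro e he f hf a b ha hb hab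
  exact h.2.2.2.1 _ (h.2.2.2.2 a ⟨ha, by linarith⟩ e he) _ (h.2.2.2.2 b ⟨hb, by linarith⟩ f hf)
    (convex_effects S (h.1 he) (h.1 hf) ha hb hab)

lemma smul_mem (h : IsConvexSubalgebra S R) {r : ℝ} (hr : 0 ≤ r) {e : S → ℝ} (he : e ∈ R)
    (hre : r • e ∈ Effects S) : r • e ∈ R := by
  obtain ⟨n, hn⟩ := exists_nat_gt r
  have hn0 : (0 : ℝ) < n := hr.trans_lt hn
  have hg : (r / n) • e ∈ R :=
    h.2.2.2.2 _ ⟨div_nonneg hr hn0.le, (div_le_one hn0).2 hn.le⟩ e he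
  have hk : ∀ k : ℕ, k ≤ n → (k : ℝ) • (r / n) • e ∈ R := by
    intro k
    induction k with
    | zero => intro _; simpa using h.zero_mem
    | succ k ih =>
      intro hkn
      have hadd : ((k + 1 : ℕ) : ℝ) • (r / n) • e = (k : ℝ) • (r / n) • e + (r / n) • e := by
        rw [Nat.cast_succ, add_smul, one_smul]
      have hscale : ((k + 1 : ℕ) : ℝ) • (r / n) • e = (((k + 1 : ℕ) : ℝ) / n) • r • e := by
        rw [smul_smul, smul_smul]
        congr 1
        ring
      have heff : ((k + 1 : ℕ) : ℝ) • (r / n) • e ∈ Effects S := by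
        rw [hscale]
        exact (convex_effects S).smul_mem_of_zero_mem (zero_mem_effects S) hre
          ⟨by positivity, (div_le_one hn0).2 (by exact_mod_cast hkn)⟩
      rw [hadd] at heff ⊢
      exact h.2.2.2.1 _ (ih (Nat.le_of_succ_le hkn)) _ hg heff
  have hfull := hk n le_rfl
  rwa [smul_smul, mul_div_cancel₀ _ hn0.ne'] at hfull

lemma sub_mem (h : IsConvexSubalgebra S R) {a b : S → ℝ} (ha : a ∈ R) (hb : b ∈ R)
    (hab : b ≤ a) : a - b ∈ R := by
  have hmem : unitEff S - a + b ∈ R := by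
    refine h.2.2.2.1 _ (h.2.2.1 a ha) b hb ⟨(affineFunctions S).add_mem
      (h.1 (h.2.2.1 a ha)).1 (h.1 hb).1, fun s => ?_, fun s => ?_⟩
    · exact add_nonneg ((h.1 (h.2.2.1 a ha)).2.1 s) ((h.1 hb).2.1 s)
    · have := hab s
      simp only [unitEff, Pi.add_apply, Pi.sub_apply]
      linarith
  have hcompl := h.2.2.1 _ hmem
  rwa [show unitEff S - (unitEff S - a + b) = a - b by abel] at hcompl

lemma exists_smul_sub_of_mem_span (h : IsConvexSubalgebra S R) {e : S → ℝ}
    (he : e ∈ Submodule.span ℝ R) : ∃ r : ℝ, 0 < r ∧ ∃ a ∈ R, ∃ b ∈ R, e = r • (a - b) := by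
  induction he using Submodule.span_induction with
  | mem x hx => exact ⟨1, one_pos, x, hx, 0, h.zero_mem, by simp⟩
  | zero => exact ⟨1, one_pos, 0, h.zero_mem, 0, h.zero_mem, by simp⟩
  | add x y _ _ hx hy =>
    obtain ⟨r, hr, a, ha, b, hb, rfl⟩ := hx
    obtain ⟨q, hq, a', ha', b', hb', rfl⟩ := hy
    have hrq : 0 < r + q := add_pos hr hq
    have hsum : r / (r + q) + q / (r + q) = 1 := by rw [← add_div, div_self hrq.ne']
    refine ⟨r + q, hrq, _, h.convex ha ha' (div_pos hr hrq).le (div_pos hq hrq).le hsum,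
      _, h.convex hb hb' (div_pos hr hrq).le (div_pos hq hrq).le hsum, ?_⟩
    ext s
    simp only [Pi.add_apply, Pi.sub_apply, Pi.smul_apply, smul_eq_mul]
    field_simp
    ring
  | smul c x _ hx =>
    obtain ⟨r, hr, a, ha, b, hb, rfl⟩ := hx
    rcases lt_trichotomy c 0 with hc | rfl | hc
    · refine ⟨-c * r, mul_pos (neg_pos.2 hc) hr, b, hb, a, ha, ?_⟩
      rw [smul_smul, neg_mul, neg_smul, ← smul_neg, neg_sub]
    · exact ⟨1, one_pos, 0, h.zero_mem, 0, h.zero_mem, by simp⟩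
    · exact ⟨c * r, mul_pos hc hr, a, ha, b, hb, smul_smul _ _ _⟩

/-- A convex subalgebra contains every effect in its linear span. -/
lemma mem_of_mem_span (h : IsConvexSubalgebra S R) {e : S → ℝ} (he : e ∈ Effects S)
    (hspan : e ∈ Submodule.span ℝ R) : e ∈ R := by
  obtain ⟨r, hr, a, ha, b, hb, rfl⟩ := h.exists_smul_sub_of_mem_span hspan
  refine h.smul_mem hr.le (h.sub_mem ha hb fun s => ?_) he
  exact sub_nonneg.1 (nonneg_of_mul_nonneg_right (he.2.1 s) hr)

end IsConvexSubalgebra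

end Effects

/-- A subset of a convex set `K ∋ 0` that is an injective affine image of `K` spans the same
space as `K`, provided that space is finite-dimensional. -/
lemma Submodule.span_eq_span_of_affine_bijOn {E : Type*} [AddCommGroup E] [Module ℝ E]
    {K R : Set E} [FiniteDimensional ℝ (Submodule.span ℝ K)] (hK : Convex ℝ K)
    (hK0 : (0 : E) ∈ K) (hRK : R ⊆ K) {Φ : E → E} (hbij : Set.BijOn Φ K R)
    (haff : ∀ x ∈ K, ∀ y ∈ K, ∀ a b : ℝ, 0 ≤ a → 0 ≤ b → a + b = 1 →
      Φ (a • x + b • y) = a • Φ x + b • Φ y) :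
    Submodule.span ℝ R = Submodule.span ℝ K := by
  classical
  obtain ⟨B, hBK, hBspan, hBli⟩ := exists_linearIndependent ℝ K
  have hle : Submodule.span ℝ R ≤ Submodule.span ℝ K := Submodule.span_mono hRK
  have : FiniteDimensional ℝ (Submodule.span ℝ R) := Submodule.finiteDimensional_of_le hle
  have hmem : ∀ x ∈ K, Φ x ∈ Submodule.span ℝ R :=
    fun x hx => Submodule.subset_span (hbij.mapsTo hx)
  let v : B → Submodule.span ℝ R :=
    fun b => ⟨Φ b - Φ 0, Submodule.sub_mem _ (hmem _ (hBK b.2)) (hmem _ hK0)⟩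
  have hG : Convex ℝ ((fun x => (Φ x, x)) '' K) := by
    rintro _ ⟨x, hx, rfl⟩ _ ⟨y, hy, rfl⟩ a b ha hb hab
    exact ⟨_, hK hx hy ha hb hab, Prod.ext (haff x hx y hy a b ha hb hab) rfl⟩
  have hfun : ∀ p ∈ (fun x => (Φ x, x)) '' K, ∀ q ∈ (fun x => (Φ x, x)) '' K,
      p.1 = q.1 → p.2 = q.2 := by
    rintro _ ⟨x, hx, rfl⟩ _ ⟨y, hy, rfl⟩ h
    exact hbij.injOn hx hy h
  have hv : LinearIndependent ℝ v := by
    rw [linearIndependent_iff']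
    intro s g hg
    have hg' : ∑ b ∈ s, g b • (Φ b - Φ 0) = 0 := by
      simpa [v] using congrArg Subtype.val hg
    have hrel := hG.sum_smul_snd_eq_zero hfun s.insertNone
      (fun o : Option B => o.elim (-∑ b ∈ s, g b) g)
      (fun o : Option B => o.elim (Φ 0, 0) fun b => (Φ b, (b : E)))
      (by
        rintro (_ | b) _
        · exact ⟨0, hK0, rfl⟩
        · exact ⟨b, hBK b.2, rfl⟩)
      (by simp [Finset.sum_insertNone])
      (by
        simp only [Finset.sum_insertNone, Option.elim]
        refine Eq.trans ?_ hg'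
        simp only [smul_sub, Finset.sum_sub_distrib, neg_smul, Finset.sum_smul]
        abel)
    simp only [Finset.sum_insertNone, Option.elim, smul_zero, zero_add] at hrel
    exact linearIndependent_iff'.1 hBli s g hrel
  have : Finite B := hv.finite
  have : Fintype B := Fintype.ofFinite B
  refine Submodule.eq_of_le_of_finrank_le hle ?_
  rw [← hBspan, finrank_span_set_eq_card hBli, Set.toFinset_card]
  exact hv.fintype_card_le_finrank

/-- If `E_R ⊊ E(S)` satisfies (E1), (E2) and there is an affine
bijection `Φ : E(S) → E_R`, then `M_{E_R}` is simulation closed but `E_R` is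
not a convex subalgebra of `E(S)`. -/
theorem affine_isomorphic_restriction
    {V : Type*} [NormedAddCommGroup V] [NormedSpace ℝ V] [FiniteDimensional ℝ V]
    {S : Set V} (hne : S.Nonempty) (hcomp : IsCompact S) (hconv : Convex ℝ S)
    (R : Set (S → ℝ)) (hR : R ⊂ Effects S)
    (h1 : CondE1 S R) (h2 : CondE2 S R)
    (Φ : (S → ℝ) → (S → ℝ))
    (hbij : Set.BijOn Φ (Effects S) R)
    (haff : ∀ e ∈ Effects S, ∀ f ∈ Effects S, ∀ l : ℝ, l ∈ Set.Icc (0:ℝ) 1 →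
      Φ (l • e + (1 - l) • f) = l • Φ e + (1 - l) • Φ f) :
    SimClosed (MetersOf R) ∧ ¬ IsConvexSubalgebra S R := by
  have hcomb : ∀ e ∈ Effects S, ∀ f ∈ Effects S, ∀ a b : ℝ, 0 ≤ a → 0 ≤ b → a + b = 1 →
      Φ (a • e + b • f) = a • Φ e + b • Φ f := by
    intro e he f hf a b ha hb hab
    obtain rfl : b = 1 - a := by linarith
    exact haff e he f hf a ⟨ha, by linarith⟩
  have hconvR : Convex ℝ R := by
    rw [← hbij.image_eq]
    rintro _ ⟨e, he, rfl⟩ _ ⟨f, hf, rfl⟩ a b ha hb hab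
    exact ⟨_, convex_effects S he hf ha hb hab, hcomb e he f hf a b ha hb hab⟩
  refine ⟨simClosed_metersOf hconvR, fun hsub => hR.2 fun e he => hsub.mem_of_mem_span he ?_⟩
  have := finiteDimensional_affineFunctions hconv
  have : FiniteDimensional ℝ (Submodule.span ℝ (Effects S)) :=
    Submodule.finiteDimensional_of_le (Submodule.span_le.2 fun _ hf => hf.1 :
      Submodule.span ℝ (Effects S) ≤ affineFunctions S)
  rw [Submodule.span_eq_span_of_affine_bijOn (convex_effects S) (zero_mem_effects S) hR.1 hbij
    hcomb]
  exact Submodule.subset_span he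
end

section
/- For any meter A, the set C(A) of all meters compatible with A is simulation closed: sim(C(A)) = C(A). -/
open scoped BigOperators

/-- Every meter is simulated by itself. -/
theorem subset_sim {V : Type*} [NormedAddCommGroup V] [NormedSpace ℝ V] {S : Set V}
    (M : Set (Meter S)) : M ⊆ Sim M := by
  intro B hB
  refine ⟨1, fun _ => B, fun _ => 1, fun _ x y => if x = y then 1 else 0, fun _ => hB,
    fun _ => zero_le_one, by simp, fun _ => ⟨fun x y => ?_, fun x => by simp⟩, fun y => ?_⟩
  · positivity
  · simp

/-- A meter lies in the simulation closure of a single meter iff it is a post-processing of it. -/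
theorem mem_sim_singleton {V : Type*} [NormedAddCommGroup V] [NormedSpace ℝ V] {S : Set V}
    {A C : Meter S} :
    A ∈ Sim {C} ↔ ∃ ν : Fin C.n → Fin A.n → ℝ, IsPostProcess ν ∧
      ∀ y, A.eff y = ∑ x, ν x y • C.eff x := by
  constructor
  · rintro ⟨m, B, p, ν, hB, hp, hp1, hν, hA⟩
    obtain rfl : B = fun _ => C := funext hB
    refine ⟨fun x y => ∑ i, p i * ν i x y, ⟨fun x y => Finset.sum_nonneg fun i _ =>
      mul_nonneg (hp i) ((hν i).1 x y), fun x => ?_⟩, fun y => ?_⟩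
    · rw [Finset.sum_comm]
      simp [← Finset.mul_sum, (hν _).2 x, hp1]
    · simp only [hA y, Finset.smul_sum, Finset.sum_smul, smul_smul]
      exact Finset.sum_comm
  · rintro ⟨ν, hν, hA⟩
    exact ⟨1, fun _ => C, fun _ => 1, fun _ => ν, fun _ => rfl, fun _ => zero_le_one, by simp,
      fun _ => hν, by simpa using hA⟩

/-- Effects are stable under scaling by numbers in the unit interval. -/
theorem smul_mem_effects {V : Type*} [NormedAddCommGroup V] [NormedSpace ℝ V] {S : Set V}
    {f : S → ℝ} (hf : f ∈ Effects S) {c : ℝ} (h0 : 0 ≤ c) (h1 : c ≤ 1) : c • f ∈ Effects S := by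
  refine ⟨fun x y hx hy a b ha hb hab h => ?_, fun s => mul_nonneg h0 (hf.2.1 s),
    fun s => mul_le_one₀ h1 (hf.2.1 s) (hf.2.2 s)⟩
  simp only [Pi.smul_apply, smul_eq_mul, hf.1 x y hx hy a b ha hb hab h]
  ring

/-- The meter that performs `C i` with probability `p i` and records `i` with the outcome. -/
noncomputable def Meter.labelledMixture {V : Type*} [NormedAddCommGroup V] [NormedSpace ℝ V]
    {S : Set V} {m : ℕ} (C : Fin m → Meter S) (p : Fin m → ℝ) (hp : ∀ i, 0 ≤ p i)
    (hp1 : ∑ i, p i = 1) : Meter S where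
  n := ∑ i, (C i).n
  eff k := p (finSigmaFinEquiv.symm k).1 •
    (C (finSigmaFinEquiv.symm k).1).eff (finSigmaFinEquiv.symm k).2
  mem_effects k := smul_mem_effects ((C _).mem_effects _) (hp _)
    (hp1 ▸ Finset.single_le_sum (fun i _ => hp i) (Finset.mem_univ _))
  sum_eq := by
    rw [Equiv.sum_comp finSigmaFinEquiv.symm
      (fun k : (i : Fin m) × Fin (C i).n => p k.1 • (C k.1).eff k.2), Fintype.sum_sigma]
    simp only [← Finset.smul_sum, (C _).sum_eq, ← Finset.sum_smul, hp1, one_smul]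

/-- A mixture of post-processings of the `C i` is simulated by their labelled mixture. -/
theorem mem_sim_labelledMixture {V : Type*} [NormedAddCommGroup V] [NormedSpace ℝ V]
    {S : Set V} {m : ℕ} (C : Fin m → Meter S) (p : Fin m → ℝ) (hp : ∀ i, 0 ≤ p i)
    (hp1 : ∑ i, p i = 1) {A : Meter S} (ν : (i : Fin m) → Fin (C i).n → Fin A.n → ℝ)
    (hν : ∀ i, IsPostProcess (ν i))
    (hA : ∀ y, A.eff y = ∑ i, p i • ∑ x, ν i x y • (C i).eff x) :
    A ∈ Sim {Meter.labelledMixture C p hp hp1} := by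
  refine mem_sim_singleton.2 ⟨fun k => ν (finSigmaFinEquiv.symm k).1 (finSigmaFinEquiv.symm k).2,
    ⟨fun k => (hν _).1 _, fun k => (hν _).2 _⟩, fun y => ?_⟩
  rw [hA]
  symm
  refine (Equiv.sum_comp finSigmaFinEquiv.symm (fun k : (i : Fin m) × Fin (C i).n =>
    ν k.1 k.2 y • p k.1 • (C k.1).eff k.2)).trans ?_
  rw [Fintype.sum_sigma]
  simp only [Finset.smul_sum, smul_comm (p _)]

/-- Composing post-processings gives a post-processing. -/
theorem IsPostProcess.comp {l m k : ℕ} {μ : Fin l → Fin m → ℝ} {ν : Fin m → Fin k → ℝ}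
    (hμ : IsPostProcess μ) (hν : IsPostProcess ν) :
    IsPostProcess fun x y => ∑ z, μ x z * ν z y := by
  refine ⟨fun x y => Finset.sum_nonneg fun z _ => mul_nonneg (hμ.1 x z) (hν.1 z y), fun x => ?_⟩
  rw [Finset.sum_comm]
  simp [← Finset.mul_sum, hν.2, hμ.2]

/-- For any meter `A`, the set of meters compatible with `A` is
simulation closed. -/
theorem compatSet_simClosed
    {V : Type*} [NormedAddCommGroup V] [NormedSpace ℝ V] [FiniteDimensional ℝ V]
    {S : Set V} (hne : S.Nonempty) (hcomp : IsCompact S) (hconv : Convex ℝ S)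
    (A : Meter S) :
    Sim (CompatSet A) = CompatSet A := by
  refine (subset_sim _).antisymm' ?_
  rintro D ⟨m, B, p, ν, hB, hp, hp1, hν, hD⟩
  choose C hAC hBC using hB
  simp only [mem_sim_singleton] at hAC hBC
  choose α hα hAα using hAC
  choose β hβ hBβ using hBC
  refine ⟨Meter.labelledMixture C p hp hp1, mem_sim_labelledMixture C p hp hp1 α hα fun y => ?_,
    mem_sim_labelledMixture C p hp hp1 _ (fun i => (hβ i).comp (hν i)) fun y => ?_⟩
  · simp only [← hAα, ← Finset.sum_smul, hp1, one_smul]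
  · rw [hD]
    refine Finset.sum_congr rfl fun i _ => ?_
    simp only [hBβ, Finset.smul_sum, Finset.sum_smul, smul_smul, mul_comm (β _ _ _)]
    rw [Finset.sum_comm]
end
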